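/- arXiv:1406.0096 — 4 statements merged into one kernel-verified Lean document; each statement's English description precedes it below -/
import Mathlib

section
/- Let P_Θ be a locally finite marked point set in ℝ² satisfying Conditions D, and let f∈𝓕. Then f is a hard-segment (HS) function if and only if f ≤ T₁f pointwise. -/
open scoped ENNReal
open Real

noncomputable section

namespace Lilypond

/-- Points of the Euclidean plane. -/
abbrev Pt := EuclideanSpace ℝ (Fin 2)

/-- A marked point: a centre in the plane together with a direction. -/
abbrev MPt := Pt × ℝ

/-- The unit vector in direction `θ`. -/
def dirVec (θ : ℝ) : Pt := (WithLp.equiv 2 (Fin 2 → ℝ)).symm ![Real.cos θ, Real.sin θ]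

/-- The full line through the centre of `p` in the direction of `p`. -/
def lineThru (p : MPt) : Set Pt := {q | ∃ t : ℝ, q = p.1 + t • dirVec p.2}

open Classical in
/-- A point of intersection of the lines through `i` and `j` (junk value if disjoint). -/
def interPt (i j : MPt) : Pt :=
  if h : (lineThru i ∩ lineThru j).Nonempty then h.choose else 0

open Classical in
/-- The distance `dᵢⱼ` from the centre of `i` to the intersection point of the lines
through `i` and `j`; if the directions coincide it is half the distance between the centres
when `j` lies on the line through `i`, and `∞` otherwise. -/
def dD (i j : MPt) : ℝ≥0∞ :=
  if i.2 = j.2 then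
    (if j.1 ∈ lineThru i then edist i.1 j.1 / 2 else ⊤)
  else edist i.1 (interPt i j)

/-- `A` is a locally finite marked point set: all directions lie in `[0, π)` and only finitely
many centres lie in any bounded region. -/
def MarkedLocFin (A : Set MPt) : Prop :=
  (∀ p ∈ A, p.2 ∈ Set.Ico 0 Real.pi) ∧
    ∀ B : Set Pt, Bornology.IsBounded B → {p ∈ A | p.1 ∈ B}.Finite

/-- Conditions D: all finite distances `dᵢⱼ` (`i ≠ j`) are mutually distinct. -/
def CondD (A : Set MPt) : Prop :=
  ∀ i ∈ A, ∀ j ∈ A, ∀ k ∈ A, ∀ l ∈ A,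
    i ≠ j → k ≠ l → (i, j) ≠ (k, l) → dD i j ≠ ⊤ → dD k l ≠ ⊤ → dD i j ≠ dD k l

/-- The set `Dᵢ(f)` of Model 1. -/
def D1 (A : Set MPt) (f : MPt → ℝ≥0∞) (i : MPt) : Set ℝ≥0∞ :=
  {x | ∃ j ∈ A, j ≠ i ∧ x = dD i j ∧ dD j i < dD i j ∧ dD j i < f j}

/-- The operator `T₁` of Model 1 (with `sInf ∅ = ∞`). -/
def T1 (A : Set MPt) (f : MPt → ℝ≥0∞) (i : MPt) : ℝ≥0∞ := sInf (D1 A f i)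

/-- The set `D⁽²⁾ᵢ(f)` of Model 2. -/
def D2 (A : Set MPt) (f : MPt → ℝ≥0∞) (i : MPt) : Set ℝ≥0∞ :=
  {x | ∃ j ∈ A, j ≠ i ∧ x = max (dD i j) (dD j i) ∧ dD j i ≤ f j}

/-- The operator `T₂` of Model 2 (with `sInf ∅ = ∞`). -/
def T2 (A : Set MPt) (f : MPt → ℝ≥0∞) (i : MPt) : ℝ≥0∞ := sInf (D2 A f i)

/-- The relative interior of the segment of half-length `r` centred at `p`. -/
def S0 (p : MPt) (r : ℝ≥0∞) : Set Pt :=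
  {q | ∃ t : ℝ, ENNReal.ofReal |t| < r ∧ q = p.1 + t • dirVec p.2}

/-- `f` is a hard-segment (HS) function on `A`. -/
def IsHS (A : Set MPt) (f : MPt → ℝ≥0∞) : Prop :=
  ∀ i ∈ A, ∀ j ∈ A, i ≠ j → Disjoint (S0 i (f i)) (S0 j (f j))

/-- `j` is a Type 1 stopping segment neighbour of `i` for `f`. -/
def StopNbr1 (A : Set MPt) (f : MPt → ℝ≥0∞) (i j : MPt) : Prop :=
  j ∈ A ∧ j ≠ i ∧ f i = dD i j ∧ dD j i < dD i j ∧ dD j i < f j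

/-- `f` is a GMHS function of Type 1 on `A`. -/
def IsGMHS1 (A : Set MPt) (f : MPt → ℝ≥0∞) : Prop :=
  IsHS A f ∧ ∀ i ∈ A, f i < ⊤ → ∃ j, StopNbr1 A f i j

/-- `j` is a Type 2 stopping segment neighbour of `i` for `f`. -/
def StopNbr2 (A : Set MPt) (f : MPt → ℝ≥0∞) (i j : MPt) : Prop :=
  j ∈ A ∧ j ≠ i ∧ f i = max (dD i j) (dD j i) ∧ dD j i ≤ f j

/-- `f` is a GMHS function of Type 2 on `A`. -/
def IsGMHS2 (A : Set MPt) (f : MPt → ℝ≥0∞) : Prop :=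
  IsHS A f ∧ ∀ i ∈ A, f i < ⊤ → ∃ j, StopNbr2 A f i j

/-- `A` has a descending chain of Type 1. -/
def HasDescChain1 (A : Set MPt) : Prop :=
  ∃ P : ℕ → MPt, (∀ n, P n ∈ A) ∧ Function.Injective P ∧
    dD (P 0) (P 1) < ⊤ ∧
    ∀ n : ℕ, dD (P (n+1)) (P n) ≤ dD (P n) (P (n+1)) ∧
      dD (P (n+1)) (P (n+2)) ≤ dD (P (n+1)) (P n)

/-- `A` has a descending chain of Type 2. -/
def HasDescChain2 (A : Set MPt) : Prop :=
  ∃ P : ℕ → MPt, (∀ n, P n ∈ A) ∧ Function.Injective P ∧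
    dD (P 1) (P 0) < ⊤ ∧
    ∀ n : ℕ, max (dD (P (n+1)) (P (n+2))) (dD (P (n+2)) (P (n+1))) ≤ dD (P (n+1)) (P n)

/-- The `T₁`-iterates `f₀ := 0`, `f_{n+1} := T₁ f_n`. -/
def iter1 (A : Set MPt) : ℕ → MPt → ℝ≥0∞
  | 0 => fun _ => 0
  | n + 1 => T1 A (iter1 A n)

/-- The monotone limit `f` of the even `T₁`-iterates. -/
def limEven1 (A : Set MPt) (p : MPt) : ℝ≥0∞ := ⨆ n, iter1 A (2 * n) p

/-- The monotone limit `g` of the odd `T₁`-iterates. -/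
def limOdd1 (A : Set MPt) (p : MPt) : ℝ≥0∞ := ⨅ n, iter1 A (2 * n + 1) p

/-- The `T₂`-iterates `f₀ := 0`, `f_{n+1} := T₂ f_n`. -/
def iter2 (A : Set MPt) : ℕ → MPt → ℝ≥0∞
  | 0 => fun _ => 0
  | n + 1 => T2 A (iter2 A n)

/-- The monotone limit `f` of the even `T₂`-iterates. -/
def limEven2 (A : Set MPt) (p : MPt) : ℝ≥0∞ := ⨆ n, iter2 A (2 * n) p

/-- The monotone limit `g` of the odd `T₂`-iterates. -/
def limOdd2 (A : Set MPt) (p : MPt) : ℝ≥0∞ := ⨅ n, iter2 A (2 * n + 1) p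


theorem norm_dirVec (θ : ℝ) : ‖dirVec θ‖ = 1 := by
  simp [EuclideanSpace.norm_eq, dirVec, Fin.sum_univ_two]

theorem mem_S0_iff (p : MPt) (r : ℝ≥0∞) (q : Pt) :
    q ∈ S0 p r ↔ q ∈ lineThru p ∧ edist p.1 q < r := by
  have key (t : ℝ) : edist p.1 (p.1 + t • dirVec p.2) = ENNReal.ofReal |t| := by
    rw [edist_dist, dist_self_add_right, norm_smul, norm_dirVec, mul_one, Real.norm_eq_abs]
  constructor
  · rintro ⟨t, ht, rfl⟩
    exact ⟨⟨t, rfl⟩, by rwa [key]⟩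
  · rintro ⟨⟨t, rfl⟩, ht⟩
    exact ⟨t, by rwa [key] at ht, rfl⟩

theorem mem_lineThru_iff_coord (p : MPt) (q : Pt) :
    q ∈ lineThru p ↔ ∃ t : ℝ, q 0 = p.1 0 + t * cos p.2 ∧ q 1 = p.1 1 + t * sin p.2 := by
  refine exists_congr fun t => ?_
  rw [PiLp.ext_iff, Fin.forall_fin_two]
  simp [dirVec]

theorem sin_sub_ne_zero {a b : ℝ} (ha : a ∈ Set.Ico 0 π) (hb : b ∈ Set.Ico 0 π) (hab : a ≠ b) :
    sin (b - a) ≠ 0 := by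
  intro h
  exact hab (sub_eq_zero.1
    ((sin_eq_zero_iff_of_lt_of_lt (by linarith [ha.2, hb.1]) (by linarith [ha.1, hb.2])).1 h)).symm

theorem lineThru_inter_nonempty {i j : MPt} (h : sin (j.2 - i.2) ≠ 0) :
    (lineThru i ∩ lineThru j).Nonempty := by
  set t := ((j.1 0 - i.1 0) * sin j.2 - (j.1 1 - i.1 1) * cos j.2) / sin (j.2 - i.2) with ht
  set s := ((j.1 0 - i.1 0) * sin i.2 - (j.1 1 - i.1 1) * cos i.2) / sin (j.2 - i.2) with hs
  refine ⟨i.1 + t • dirVec i.2, ⟨t, rfl⟩, (mem_lineThru_iff_coord _ _).2 ⟨s, ?_, ?_⟩⟩ <;>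
  · simp only [dirVec, WithLp.equiv_symm_apply, PiLp.add_apply, PiLp.smul_apply, smul_eq_mul,
      Matrix.cons_val_zero, Matrix.cons_val_one, ht, hs]
    field_simp
    rw [sin_sub]
    ring

theorem eq_of_mem_lineThru {i j : MPt} (h : sin (j.2 - i.2) ≠ 0) {p q : Pt}
    (hpi : p ∈ lineThru i) (hpj : p ∈ lineThru j) (hqi : q ∈ lineThru i) (hqj : q ∈ lineThru j) :
    p = q := by
  obtain ⟨t, ht⟩ := hpi
  obtain ⟨t', ht'⟩ := hqi
  obtain ⟨s, h0, h1⟩ := (mem_lineThru_iff_coord _ _).1 hpj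
  obtain ⟨s', h0', h1'⟩ := (mem_lineThru_iff_coord _ _).1 hqj
  rw [sin_sub] at h
  have hz : (t - t') * (sin j.2 * cos i.2 - cos j.2 * sin i.2) = 0 := by
    simp only [ht, ht', dirVec, WithLp.equiv_symm_apply, PiLp.add_apply, PiLp.smul_apply,
      smul_eq_mul, Matrix.cons_val_zero, Matrix.cons_val_one] at h0 h1 h0' h1'
    linear_combination sin j.2 * (h0 - h0') - cos j.2 * (h1 - h1')
  rw [ht, ht', sub_eq_zero.1 ((mul_eq_zero.1 hz).resolve_right h)]

theorem dD_eq_edist {i j : MPt} (hi : i.2 ∈ Set.Ico 0 π) (hj : j.2 ∈ Set.Ico 0 π)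
    (hij : i.2 ≠ j.2) {q : Pt} (hqi : q ∈ lineThru i) (hqj : q ∈ lineThru j) :
    dD i j = edist i.1 q := by
  have hs := sin_sub_ne_zero hi hj hij
  have hne : (lineThru i ∩ lineThru j).Nonempty := ⟨q, hqi, hqj⟩
  have hq : interPt i j = q := by
    rw [interPt, dif_pos hne]
    exact eq_of_mem_lineThru hs hne.choose_spec.1 hne.choose_spec.2 hqi hqj
  rw [dD, if_neg hij, hq]

theorem center_mem_lineThru_of_mem {i j : MPt} (hij : i.2 = j.2) {q : Pt}
    (hqi : q ∈ lineThru i) (hqj : q ∈ lineThru j) : j.1 ∈ lineThru i := by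
  obtain ⟨t, rfl⟩ := hqi
  obtain ⟨s, hs⟩ := hqj
  refine ⟨t - s, ?_⟩
  rw [sub_smul, ← add_sub_assoc, hs, hij, add_sub_cancel_right]

theorem center_mem_lineThru (p : MPt) : p.1 ∈ lineThru p := ⟨0, by simp⟩

theorem dD_comm_of_eq {i j : MPt} (hij : i.2 = j.2) : dD i j = dD j i := by
  have h : j.1 ∈ lineThru i ↔ i.1 ∈ lineThru j :=
    ⟨fun h => center_mem_lineThru_of_mem hij.symm (center_mem_lineThru j) h,
      fun h => center_mem_lineThru_of_mem hij (center_mem_lineThru i) h⟩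
  rw [dD, dD, if_pos hij, if_pos hij.symm, edist_comm i.1 j.1]
  classical exact if_congr h rfl rfl

theorem CondD.dD_ne_swap {A : Set MPt} (hD : CondD A) {i j : MPt} (hi : i ∈ A) (hj : j ∈ A)
    (hij : i ≠ j) (h : dD i j ≠ ⊤) (h' : dD j i ≠ ⊤) : dD i j ≠ dD j i :=
  hD i hi j hj j hj i hi hij hij.symm (fun e => hij (congrArg Prod.fst e)) h h'

theorem dir_ne_of_mem_lineThru {A : Set MPt} (hD : CondD A) {i j : MPt} (hi : i ∈ A) (hj : j ∈ A)
    (hij : i ≠ j) {q : Pt} (hqi : q ∈ lineThru i) (hqj : q ∈ lineThru j) : i.2 ≠ j.2 := by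
  intro hdir
  have hfin : dD i j ≠ ⊤ := by
    rw [dD, if_pos hdir, if_pos (center_mem_lineThru_of_mem hdir hqi hqj)]
    exact ENNReal.div_ne_top (edist_ne_top _ _) two_ne_zero
  exact hD.dD_ne_swap hi hj hij hfin (dD_comm_of_eq hdir ▸ hfin) (dD_comm_of_eq hdir)

/-- Lemma 4.6: `f` is a hard-segment function iff `f ≤ T₁f` on `P_Θ`. -/
theorem statement3 (A : Set MPt) (hA : MarkedLocFin A) (hD : CondD A)
    (f : MPt → ℝ≥0∞) :
    IsHS A f ↔ ∀ p ∈ A, f p ≤ T1 A f p := by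
  constructor
  · intro hHS i hi
    refine le_sInf ?_
    rintro _ ⟨j, hj, hji, rfl, hlt, hfj⟩
    by_contra! hfi
    have hdir : i.2 ≠ j.2 := fun h => hlt.ne' (dD_comm_of_eq h)
    have hi' := hA.1 i hi
    have hj' := hA.1 j hj
    obtain ⟨q, hqi, hqj⟩ := lineThru_inter_nonempty (sin_sub_ne_zero hi' hj' hdir)
    rw [dD_eq_edist hi' hj' hdir hqi hqj] at hfi
    rw [dD_eq_edist hj' hi' hdir.symm hqj hqi] at hfj
    exact Set.disjoint_left.1 (hHS i hi j hj hji.symm)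
      ((mem_S0_iff _ _ _).2 ⟨hqi, hfi⟩) ((mem_S0_iff _ _ _).2 ⟨hqj, hfj⟩)
  · intro hf i hi j hj hij
    refine Set.disjoint_left.2 fun q hq hq' => ?_
    obtain ⟨hqi, hfi⟩ := (mem_S0_iff _ _ _).1 hq
    obtain ⟨hqj, hfj⟩ := (mem_S0_iff _ _ _).1 hq'
    have hdir := dir_ne_of_mem_lineThru hD hi hj hij hqi hqj
    have hdi := dD_eq_edist (hA.1 i hi) (hA.1 j hj) hdir hqi hqj
    have hdj := dD_eq_edist (hA.1 j hj) (hA.1 i hi) hdir.symm hqj hqi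
    have hne := hD.dD_ne_swap hi hj hij (hdi ▸ edist_ne_top _ _) (hdj ▸ edist_ne_top _ _)
    rw [← hdi] at hfi
    rw [← hdj] at hfj
    rcases hne.lt_or_gt with h | h
    · exact hfj.not_ge ((hf j hj).trans (sInf_le ⟨i, hi, hij, rfl, h, hfi⟩))
    · exact hfi.not_ge ((hf i hi).trans (sInf_le ⟨j, hj, hij.symm, rfl, h, hfj⟩))

end Lilypond
end
end

section
/- Let P_Θ be a locally finite marked point set in ℝ² satisfying Conditions D, and define the T₁-iterates f₀:=0, f_{n+1}:=T₁f_n with monotone limits f and g. If Pᶿᵢ∈P_Θ satisfies f(Pᶿᵢ) < ∞, then f_{2n}(Pᶿᵢ) = f(Pᶿᵢ) for all sufficiently large n; similarly, if g(Pᶿⱼ) < ∞, then f_{2n+1}(Pᶿⱼ) = g(Pᶿⱼ) for all sufficiently large n. -/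
open scoped ENNReal
open Real

noncomputable section

namespace Lilypond

theorem sInf_mem_of_finite_inter_Iio {S : Set ℝ≥0∞} {R : ℝ≥0∞} (hfin : (S ∩ Set.Iio R).Finite)
    (h : sInf S < R) : sInf S ∈ S := by
  obtain ⟨x, hx, hxR⟩ := sInf_lt_iff.1 h
  have hmem : sInf (S ∩ Set.Iio R) ∈ S ∩ Set.Iio R :=
    Set.Nonempty.csInf_mem ⟨x, hx, hxR⟩ hfin
  have heq : sInf S = sInf (S ∩ Set.Iio R) := by
    refine le_antisymm (sInf_le_sInf Set.inter_subset_left) (le_sInf fun y hy => ?_)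
    rcases lt_or_ge y R with hyR | hyR
    · exact sInf_le ⟨hy, hyR⟩
    · exact hmem.2.le.trans hyR
  rw [heq]
  exact hmem.1

theorem interPt_comm (i j : MPt) : interPt i j = interPt j i := by
  have key : ∀ S T : Set Pt, S = T → ∀ (hS : S.Nonempty) (hT : T.Nonempty),
      hS.choose = hT.choose := by
    rintro S _ rfl _ _
    rfl
  unfold interPt
  have hc := Set.inter_comm (lineThru i) (lineThru j)
  by_cases h : (lineThru i ∩ lineThru j).Nonempty
  · rw [dif_pos h, dif_pos (hc ▸ h)]
    exact key _ _ hc _ _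
  · rw [dif_neg h, dif_neg (hc ▸ h)]

theorem edist_le_two_mul_dD {i j : MPt} (h : dD j i < dD i j) : edist i.1 j.1 ≤ 2 * dD i j := by
  by_cases hθ : i.2 = j.2
  · by_cases hl : j.1 ∈ lineThru i
    · rw [dD, if_pos hθ, if_pos hl, ENNReal.mul_div_cancel (by simp) (by simp)]
    · rw [dD, if_pos hθ, if_neg hl]
      simp
  · have hij : dD i j = edist i.1 (interPt i j) := by rw [dD, if_neg hθ]
    have hji : dD j i = edist (interPt i j) j.1 := by
      rw [dD, if_neg (Ne.symm hθ), interPt_comm, edist_comm]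
    calc edist i.1 j.1 ≤ dD i j + dD j i := by
          rw [hij, hji]
          exact edist_triangle _ _ _
      _ ≤ 2 * dD i j := by
          rw [two_mul]
          gcongr

/-- The distances below `R` that can occur as values of `T₁` at `p`. -/
def stopDists (A : Set MPt) (p : MPt) (R : ℝ≥0∞) : Set ℝ≥0∞ :=
  dD p '' {j ∈ A | dD j p < dD p j ∧ dD p j < R}

theorem finite_stopDists {A : Set MPt} (hA : MarkedLocFin A) (p : MPt) {R : ℝ≥0∞} (hR : R ≠ ⊤) :
    (stopDists A p R).Finite := by
  refine Set.Finite.image _ ((hA.2 (Metric.closedBall p.1 (2 * R).toReal)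
    Metric.isBounded_closedBall).subset ?_)
  rintro j ⟨hj, hlt, hjR⟩
  refine ⟨hj, ?_⟩
  rw [Metric.mem_closedBall, dist_comm, dist_edist]
  refine ENNReal.toReal_mono (ENNReal.mul_ne_top (by simp) hR) ?_
  exact (edist_le_two_mul_dD hlt).trans (by gcongr)

theorem T1_mem_stopDists {A : Set MPt} (hA : MarkedLocFin A) (f : MPt → ℝ≥0∞) {p : MPt}
    {R : ℝ≥0∞} (hR : R ≠ ⊤) (h : T1 A f p < R) : T1 A f p ∈ stopDists A p R := by
  have hsub : D1 A f p ∩ Set.Iio R ⊆ stopDists A p R := by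
    rintro _ ⟨⟨j, hj, -, rfl, hlt, -⟩, hjR⟩
    exact ⟨j, ⟨hj, hlt, hjR⟩, rfl⟩
  exact hsub ⟨sInf_mem_of_finite_inter_Iio ((finite_stopDists hA p hR).subset hsub) h, h⟩

theorem T1_antitone (A : Set MPt) : Antitone (T1 A) := by
  intro f g hfg p
  refine sInf_le_sInf ?_
  rintro x ⟨j, hj, hne, hx, hlt, hf⟩
  exact ⟨j, hj, hne, hx, hlt, hf.trans_le (hfg j)⟩

theorem iter1_even_odd_step (A : Set MPt) (n : ℕ) :
    iter1 A (2 * n) ≤ iter1 A (2 * (n + 1)) ∧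
      iter1 A (2 * (n + 1) + 1) ≤ iter1 A (2 * n + 1) := by
  induction n with
  | zero =>
    have h : iter1 A 0 ≤ iter1 A 2 := fun _ => zero_le
    exact ⟨h, T1_antitone A h⟩
  | succ n ih =>
    have h := T1_antitone A ih.2
    exact ⟨h, T1_antitone A h⟩

theorem monotone_iter1_even (A : Set MPt) (p : MPt) : Monotone fun n => iter1 A (2 * n) p :=
  monotone_nat_of_le_succ fun n => (iter1_even_odd_step A n).1 p

theorem antitone_iter1_odd (A : Set MPt) (p : MPt) : Antitone fun n => iter1 A (2 * n + 1) p :=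
  antitone_nat_of_succ_le fun n => (iter1_even_odd_step A n).2 p

/-- Lemma 4.9: the even (resp. odd) `T₁`-iterates are eventually equal to their limit
wherever that limit is finite. -/
theorem statement6 (A : Set MPt) (hA : MarkedLocFin A) (hD : CondD A) :
    (∀ p ∈ A, limEven1 A p < ⊤ →
      ∃ N : ℕ, ∀ n ≥ N, iter1 A (2 * n) p = limEven1 A p) ∧
    (∀ p ∈ A, limOdd1 A p < ⊤ →
      ∃ N : ℕ, ∀ n ≥ N, iter1 A (2 * n + 1) p = limOdd1 A p) := by
  refine ⟨fun p _ hp => ?_, fun p _ hp => ?_⟩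
  · have hlt : limEven1 A p < limEven1 A p + 1 := ENNReal.lt_add_right hp.ne one_ne_zero
    have hR : limEven1 A p + 1 ≠ ⊤ := by simpa using hp.ne
    have hfin : (Set.range fun n => iter1 A (2 * n) p).Finite := by
      refine ((finite_stopDists hA p hR).insert 0).subset ?_
      rintro _ ⟨n, rfl⟩
      cases n with
      | zero => exact Or.inl rfl
      | succ n =>
        exact Or.inr (T1_mem_stopDists hA _ hR
          ((le_iSup (fun n => iter1 A (2 * n) p) (n + 1)).trans_lt hlt))
    obtain ⟨N, hN⟩ := (Set.range_nonempty _).csSup_mem hfin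
    refine ⟨N, fun n hn => le_antisymm (le_iSup (fun n => iter1 A (2 * n) p) n) ?_⟩
    exact hN.ge.trans (monotone_iter1_even A p hn)
  · have hlt : limOdd1 A p < limOdd1 A p + 1 := ENNReal.lt_add_right hp.ne one_ne_zero
    have hR : limOdd1 A p + 1 ≠ ⊤ := by simpa using hp.ne
    have hfin : ((Set.range fun n => iter1 A (2 * n + 1) p) ∩
        Set.Iio (limOdd1 A p + 1)).Finite := by
      refine (finite_stopDists hA p hR).subset ?_
      rintro _ ⟨⟨n, rfl⟩, hn⟩
      exact T1_mem_stopDists hA _ hR hn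
    obtain ⟨N, hN⟩ := sInf_mem_of_finite_inter_Iio hfin hlt
    refine ⟨N, fun n hn => le_antisymm ?_ (iInf_le (fun n => iter1 A (2 * n + 1) p) n)⟩
    exact (antitone_iter1_odd A p hn).trans hN.le

end Lilypond
end
end

section
/- Let P_Θ be a locally finite marked point set in ℝ² satisfying Conditions D, and define the T₁-iterates f₀:=0, f_{n+1}:=T₁f_n with monotone limits f and g. Then T₁f = g and T₁g = f. -/
open scoped ENNReal
open Real

noncomputable section

namespace Lilypond

theorem finite_dD_le {A : Set MPt} (hA : MarkedLocFin A) (i : MPt) {R : ℝ≥0∞} (hR : R ≠ ⊤) :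
    {j ∈ A | dD j i < dD i j ∧ dD i j ≤ R}.Finite := by
  have hfin : 2 * R ≠ ⊤ := ENNReal.mul_ne_top (by simp) hR
  refine (hA.2 (Metric.closedBall i.1 (2 * R).toReal) Metric.isBounded_closedBall).subset ?_
  rintro j ⟨hj, hlt, hle⟩
  refine ⟨hj, ?_⟩
  rw [Metric.mem_closedBall, dist_comm, dist_edist]
  exact ENNReal.toReal_mono hfin ((edist_le_two_mul_dD hlt).trans (by gcongr))

theorem T1_mem_D1 {A : Set MPt} (hA : MarkedLocFin A) {f : MPt → ℝ≥0∞} {i : MPt}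
    (h : T1 A f i ≠ ⊤) : T1 A f i ∈ D1 A f i := by
  obtain ⟨_, ⟨k, hk, hki, rfl, hklt, hkf⟩, hx⟩ := sInf_lt_iff.1 (lt_top_iff_ne_top.2 h)
  have hfin : {j ∈ A | j ≠ i ∧ dD j i < dD i j ∧ dD i j ≤ dD i k ∧ dD j i < f j}.Finite :=
    (finite_dD_le hA i hx.ne).subset fun j hj => ⟨hj.1, hj.2.2.1, hj.2.2.2.1⟩
  obtain ⟨j, ⟨hj, hji, hjlt, hjk, hjf⟩, hmin⟩ :=
    Set.exists_min_image _ (dD i) hfin ⟨k, hk, hki, hklt, le_rfl, hkf⟩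
  have hmem : dD i j ∈ D1 A f i := ⟨j, hj, hji, rfl, hjlt, hjf⟩
  have heq : T1 A f i = dD i j := by
    refine le_antisymm (sInf_le hmem) (le_sInf ?_)
    rintro _ ⟨l, hl, hli, rfl, hllt, hlf⟩
    rcases le_total (dD i l) (dD i k) with hlk | hlk
    · exact hmin l ⟨hl, hli, hllt, hlk, hlf⟩
    · exact hjk.trans hlk
  rwa [heq]

theorem iter1_even_le_succ (A : Set MPt) (n : ℕ) :
    iter1 A (2 * n) ≤ iter1 A (2 * (n + 1)) := by
  induction n with
  | zero => exact fun _ => zero_le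
  | succ n ih => exact T1_antitone A (T1_antitone A ih)

theorem iter1_odd_antitone (A : Set MPt) : Antitone fun n => iter1 A (2 * n + 1) :=
  antitone_nat_of_succ_le fun n => T1_antitone A (iter1_even_le_succ A n)

theorem T1_limEven1 (A : Set MPt) : T1 A (limEven1 A) = limOdd1 A := by
  funext i
  refine le_antisymm (le_iInf fun n => ?_) (le_sInf ?_)
  · exact T1_antitone A (fun p => le_iSup (fun n => iter1 A (2 * n) p) n) i
  · rintro _ ⟨j, hj, hji, rfl, hlt, hf⟩
    obtain ⟨n, hn⟩ := lt_iSup_iff.1 hf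
    exact (iInf_le _ n).trans (sInf_le ⟨j, hj, hji, rfl, hlt, hn⟩)

theorem limEven1_le_T1_limOdd1 (A : Set MPt) : limEven1 A ≤ T1 A (limOdd1 A) := by
  refine fun i => iSup_le fun n => (iter1_even_le_succ A n i).trans ?_
  exact T1_antitone A (fun p => iInf_le (fun n => iter1 A (2 * n + 1) p) n) i

theorem limOdd1_ne_dD {A : Set MPt} (hA : MarkedLocFin A) (hD : CondD A) {i j : MPt}
    (hi : i ∈ A) (hj : j ∈ A) (hji : j ≠ i) (hlt : dD j i < dD i j) :
    limOdd1 A j ≠ dD j i := by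
  intro h
  rw [← T1_limEven1] at h
  have htop : dD j i ≠ ⊤ := hlt.ne_top
  obtain ⟨k, hk, hkj, hx, hklt, -⟩ := T1_mem_D1 hA (h ▸ htop)
  rw [h] at hx
  by_cases hki : k = i
  · subst hki
    exact lt_asymm hlt hklt
  · exact hD j hj i hi j hj k hk hji hkj.symm (by simpa using Ne.symm hki) htop
      (hx ▸ htop) hx

theorem T1_limOdd1_le {A : Set MPt} (hA : MarkedLocFin A) (hD : CondD A) {i : MPt}
    (hi : i ∈ A) : T1 A (limOdd1 A) i ≤ limEven1 A i := by
  by_cases htop : limEven1 A i = ⊤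
  · simp [htop]
  have hex : ∀ n, ∃ j ∈ {j ∈ A | dD j i < dD i j ∧ dD i j ≤ limEven1 A i},
      j ≠ i ∧ dD j i < iter1 A (2 * n + 1) j := by
    intro n
    have hle : T1 A (iter1 A (2 * n + 1)) i ≤ limEven1 A i :=
      le_iSup (fun n => iter1 A (2 * n) i) (n + 1)
    obtain ⟨j, hj, hji, hx, hlt, hf⟩ := T1_mem_D1 hA (ne_top_of_le_ne_top htop hle)
    exact ⟨j, ⟨hj, hlt, hx ▸ hle⟩, hji, hf⟩
  obtain ⟨j, ⟨hj, hlt, hle⟩, hall⟩ :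
      ∃ j ∈ {j ∈ A | dD j i < dD i j ∧ dD i j ≤ limEven1 A i},
        ∀ n, j ≠ i ∧ dD j i < iter1 A (2 * n + 1) j := by
    by_contra! hcon
    have hev : ∀ j ∈ {j ∈ A | dD j i < dD i j ∧ dD i j ≤ limEven1 A i},
        ∀ᶠ n in Filter.atTop, ¬ (j ≠ i ∧ dD j i < iter1 A (2 * n + 1) j) := by
      intro j hj
      obtain ⟨N, hN⟩ := hcon j hj
      filter_upwards [Filter.eventually_ge_atTop N] with n hn h
      exact (hN h.1).not_gt (h.2.trans_le (iter1_odd_antitone A hn j))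
    obtain ⟨n, hn⟩ := ((Filter.eventually_all_finite (finite_dD_le hA i htop)).2 hev).exists
    obtain ⟨j, hj, h⟩ := hex n
    exact hn j hj h
  have hji : j ≠ i := (hall 0).1
  have hg : dD j i < limOdd1 A j :=
    lt_of_le_of_ne (le_iInf fun n => (hall n).2.le) (limOdd1_ne_dD hA hD hi hj hji hlt).symm
  have hmem : dD i j ∈ D1 A (limOdd1 A) i := ⟨j, hj, hji, rfl, hlt, hg⟩
  exact (sInf_le hmem).trans hle

/-- Lemma 4.10: `T₁f = g` and `T₁g = f` for the monotone limits `f`, `g` of the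
`T₁`-iterates. -/
theorem statement7 (A : Set MPt) (hA : MarkedLocFin A) (hD : CondD A) :
    Set.EqOn (T1 A (limEven1 A)) (limOdd1 A) A ∧
      Set.EqOn (T1 A (limOdd1 A)) (limEven1 A) A := by
  refine ⟨fun i _ => congrFun (T1_limEven1 A) i, fun i hi => ?_⟩
  exact le_antisymm (T1_limOdd1_le hA hD hi) (limEven1_le_T1_limOdd1 A i)

end Lilypond
end
end

section
/- Let P_Θ be a locally finite marked point set in ℝ² satisfying Conditions D, let f∈𝓕 and let Pᶿᵢ∈P_Θ satisfy T₂f(Pᶿᵢ) < ∞. Then there exists Pᶿⱼ∈P_Θ∖{Pᶿᵢ} such that T₂f(Pᶿᵢ) = max{dᵢⱼ, dⱼᵢ} and f(Pᶿⱼ) ≥ dⱼᵢ; in particular the infimum defining T₂f(Pᶿᵢ) is attained. -/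
open scoped ENNReal
open Real

noncomputable section

namespace Lilypond

theorem edist_le_dD_add_dD (i j : MPt) : edist i.1 j.1 ≤ dD i j + dD j i := by
  by_cases h : i.2 = j.2
  · by_cases hij : j.1 ∈ lineThru i
    · by_cases hji : i.1 ∈ lineThru j
      · simp [dD, h, hij, hji, edist_comm j.1 i.1, ENNReal.add_halves]
      · simp [dD, h, hji]
    · simp [dD, h, hij]
  · rw [dD, dD, if_neg h, if_neg (Ne.symm h), interPt_comm j i, edist_comm j.1]
    exact edist_triangle _ _ _

theorem MarkedLocFin.finite_max_dD_le {A : Set MPt} (hA : MarkedLocFin A) (i : MPt)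
    {c : ℝ≥0∞} (hc : c ≠ ⊤) : {j ∈ A | max (dD i j) (dD j i) ≤ c}.Finite := by
  refine (hA.2 (Metric.eball i.1 (c + c + 1)) ?_).subset ?_
  · have hr : c + c + 1 ≠ ⊤ := by simp [hc]
    rw [← ENNReal.ofReal_toReal hr, Metric.eball_ofReal]
    exact Metric.isBounded_ball
  · rintro j ⟨hj, hjc⟩
    refine ⟨hj, ?_⟩
    rw [Metric.mem_eball, edist_comm]
    calc edist i.1 j.1 ≤ dD i j + dD j i := edist_le_dD_add_dD i j
      _ ≤ c + c := add_le_add ((le_max_left _ _).trans hjc) ((le_max_right _ _).trans hjc)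
      _ < c + c + 1 := ENNReal.lt_add_right (by simp [hc]) one_ne_zero

theorem MarkedLocFin.T2_mem_D2 {A : Set MPt} (hA : MarkedLocFin A) (f : MPt → ℝ≥0∞)
    (i : MPt) (hfin : T2 A f i < ⊤) : T2 A f i ∈ D2 A f i := by
  obtain ⟨c, hc, hct⟩ := sInf_lt_iff.mp hfin
  have hS : (D2 A f i ∩ Set.Iic c).Finite := by
    refine ((hA.finite_max_dD_le i hct.ne).image fun j => max (dD i j) (dD j i)).subset ?_
    rintro x ⟨⟨j, hj, -, rfl, -⟩, hx⟩
    exact ⟨j, ⟨hj, hx⟩, rfl⟩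
  obtain ⟨m, ⟨hm, hmc⟩, hmin⟩ := Set.exists_min_image _ id hS ⟨c, hc, Set.self_mem_Iic⟩
  have hleast : IsLeast (D2 A f i) m := by
    refine ⟨hm, fun x hx => ?_⟩
    rcases le_total x c with h | h
    · exact hmin x ⟨hx, h⟩
    · exact le_trans hmc h
  rw [T2, hleast.isGLB.sInf_eq]
  exact hm

/-- Lemma 4.15: if `T₂f(Pᶿᵢ) < ∞` then the infimum defining it is attained at some
`Pᶿⱼ` with `T₂f(Pᶿᵢ) = max{dᵢⱼ, dⱼᵢ}` and `f(Pᶿⱼ) ≥ dⱼᵢ`. -/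
theorem statement12 (A : Set MPt) (hA : MarkedLocFin A) (hD : CondD A)
    (f : MPt → ℝ≥0∞) (i : MPt) (hi : i ∈ A) (hfin : T2 A f i < ⊤) :
    (∃ j ∈ A, j ≠ i ∧ T2 A f i = max (dD i j) (dD j i) ∧ dD j i ≤ f j) ∧
      T2 A f i ∈ D2 A f i := by
  have h := hA.T2_mem_D2 f i hfin
  exact ⟨h, h⟩

end Lilypond
end
end
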